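/- Let C ⊆ ℤ² be a simple closed 4-curve with at least 5 points, i.e., C is finite, 4-connected, and every point of C has exactly two 4-adjacent points in C. Then ℤ² \ C has exactly two 8-connected components, exactly one of which is finite (digital Jordan curve theorem). -/

import Mathlib

/-- 4-adjacency on ℤ². -/
def Adj4 (p q : ℤ × ℤ) : Prop := |p.1 - q.1| + |p.2 - q.2| = 1

/-- 8-adjacency on ℤ². -/
def Adj8 (p q : ℤ × ℤ) : Prop := max |p.1 - q.1| |p.2 - q.2| = 1 ∧ p ≠ q

/-- `p` and `q` are joined by a path within `A` whose consecutive points are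
`adj`-adjacent. -/
def ReachIn (adj : ℤ × ℤ → ℤ × ℤ → Prop) (A : Set (ℤ × ℤ)) (p q : ℤ × ℤ) : Prop :=
  Relation.ReflTransGen (fun a b => a ∈ A ∧ b ∈ A ∧ adj a b) p q

/-- `A` is `adj`-connected. -/
def IsConn (adj : ℤ × ℤ → ℤ × ℤ → Prop) (A : Set (ℤ × ℤ)) : Prop :=
  ∀ p ∈ A, ∀ q ∈ A, ReachIn adj A p q

/-- The 8-connected components of `A`: its maximal 8-connected subsets. -/
def Components8 (A : Set (ℤ × ℤ)) : Set (Set (ℤ × ℤ)) :=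
  {D | ∃ p ∈ A, D = {q ∈ A | ReachIn Adj8 A p q}}

lemma adj4_iff {x y a b : ℤ} : Adj4 (x, y) (a, b) ↔
    (a, b) = (x + 1, y) ∨ (a, b) = (x - 1, y) ∨ (a, b) = (x, y + 1) ∨ (a, b) = (x, y - 1) := by
  simp only [Adj4, Prod.mk.injEq]
  rcases abs_cases (x - a) with h | h <;> rcases abs_cases (y - b) with h' | h' <;> omega

open Classical in
/-- The number of neighbours of a point of the curve, written as a sum of indicators. -/
lemma sum_indicator_neighbors {C : Set (ℤ × ℤ)}
    (hdeg : ∀ p ∈ C, {q ∈ C | Adj4 p q}.ncard = 2) {x y : ℤ} (h : (x, y) ∈ C) :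
    (if (x + 1, y) ∈ C then 1 else 0) + (if (x - 1, y) ∈ C then 1 else 0) +
      (if (x, y + 1) ∈ C then 1 else 0) + (if (x, y - 1) ∈ C then 1 else 0) = 2 := by
  have hset : {q ∈ C | Adj4 (x, y) q} =
      (({(x + 1, y), (x - 1, y), (x, y + 1), (x, y - 1)} : Finset (ℤ × ℤ)).filter (· ∈ C) :
        Set (ℤ × ℤ)) := by
    ext ⟨a, b⟩
    simp only [adj4_iff, Set.mem_ofPred_eq, Finset.coe_filter, Finset.mem_insert,
      Finset.mem_singleton]
    exact and_comm
  have h2 := hdeg _ h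
  rw [hset, Set.ncard_coe_finset, Finset.card_filter, Finset.sum_insert, Finset.sum_insert,
    Finset.sum_insert, Finset.sum_singleton] at h2
  · rw [← h2]; ring
  all_goals
    simp only [Finset.mem_insert, Finset.mem_singleton, Prod.mk.injEq]
    omega

/-- `c` is a corner of the unit square whose lower left corner is `F`. -/
def IsSquareCorner (c F : ℤ × ℤ) : Prop :=
  F.1 ≤ c.1 ∧ c.1 ≤ F.1 + 1 ∧ F.2 ≤ c.2 ∧ c.2 ≤ F.2 + 1

lemma IsSquareCorner.adj8 {c d F : ℤ × ℤ} (hc : IsSquareCorner c F) (hd : IsSquareCorner d F)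
    (h : c ≠ d) :
    Adj8 c d := by
  obtain ⟨a, b⟩ := c
  obtain ⟨a', b'⟩ := d
  simp only [IsSquareCorner, Adj8, ne_eq, Prod.mk.injEq] at *
  grind

lemma Adj8.exists_isSquareCorner {p q : ℤ × ℤ} (h : Adj8 p q) :
    ∃ F, IsSquareCorner p F ∧ IsSquareCorner q F := by
  obtain ⟨a, b⟩ := p
  obtain ⟨a', b'⟩ := q
  refine ⟨(min a a', min b b'), ?_⟩
  simp only [IsSquareCorner, Adj8, ne_eq, Prod.mk.injEq] at *
  grind

lemma Adj4.adj8 {p q : ℤ × ℤ} (h : Adj4 p q) : Adj8 p q := by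
  obtain ⟨a, b⟩ := p
  obtain ⟨a', b'⟩ := q
  simp only [Adj4, Adj8, ne_eq, Prod.mk.injEq] at *
  grind

lemma Adj8.symm {p q : ℤ × ℤ} (h : Adj8 p q) : Adj8 q p := by
  obtain ⟨h, hne⟩ := h
  exact ⟨by rwa [abs_sub_comm q.1, abs_sub_comm q.2], hne.symm⟩

lemma ReachIn.symm_of_adj8 {A : Set (ℤ × ℤ)} {p q : ℤ × ℤ} (h : ReachIn Adj8 A p q) :
    ReachIn Adj8 A q p := by
  induction h with
  | refl => exact .refl
  | tail _ hbc ih => exact .head ⟨hbc.2.1, hbc.1, hbc.2.2.symm⟩ ih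

/-- Every unit square has a corner off the curve. -/
lemma exists_isSquareCorner_notMem {C : Set (ℤ × ℤ)} (hcard : 5 ≤ C.ncard)
    (hconn : IsConn Adj4 C) (hdeg : ∀ p ∈ C, {q ∈ C | Adj4 p q}.ncard = 2) (F : ℤ × ℤ) :
    ∃ c ∉ C, IsSquareCorner c F := by
  obtain ⟨i, j⟩ := F
  by_contra! hno
  have hin (a b : ℤ) (h : IsSquareCorner (a, b) (i, j)) : (a, b) ∈ C := by
    by_contra h'
    exact hno _ h' h
  simp only [IsSquareCorner] at hin
  have h00 : (i, j) ∈ C := hin _ _ (by omega)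
  have h10 : (i + 1, j) ∈ C := hin _ _ (by omega)
  have h01 : (i, j + 1) ∈ C := hin _ _ (by omega)
  have h11 : (i + 1, j + 1) ∈ C := hin _ _ (by omega)
  have s00 := sum_indicator_neighbors hdeg h00
  have s10 := sum_indicator_neighbors hdeg h10
  have s01 := sum_indicator_neighbors hdeg h01
  have s11 := sum_indicator_neighbors hdeg h11
  simp only [add_sub_cancel_right, h00, h10, h01, h11, if_true] at s00 s10 s01 s11
  have hsub : C ⊆ (({(i, j), (i + 1, j), (i, j + 1), (i + 1, j + 1)} : Finset (ℤ × ℤ)) :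
      Set (ℤ × ℤ)) := by
    intro q hq
    have hreach := hconn _ h00 _ hq
    clear hq
    induction hreach with
    | refl => simp
    | @tail b c _ hbc ih =>
      obtain ⟨a, b⟩ := b
      obtain ⟨a', b'⟩ := c
      obtain ⟨-, hc, hadj⟩ := hbc
      have hn := adj4_iff.1 hadj
      simp only [Finset.coe_insert, Finset.coe_singleton, Set.mem_insert_iff,
        Set.mem_singleton_iff] at ih ⊢
      grind
  have := Set.ncard_le_ncard hsub (Finset.finite_toSet _)
  rw [Set.ncard_coe_finset] at this
  have := this.trans Finset.card_le_four
  omega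

/-- The 8-component of `A` which contains the corners of the unit square `F` lying in `A`. -/
def faceComponent (A : Set (ℤ × ℤ)) (F : ℤ × ℤ) : Set (ℤ × ℤ) :=
  {q ∈ A | ∃ c ∈ A, IsSquareCorner c F ∧ ReachIn Adj8 A c q}

lemma faceComponent_eq {A : Set (ℤ × ℤ)} {c F : ℤ × ℤ} (hc : c ∈ A) (hF : IsSquareCorner c F) :
    faceComponent A F = {q ∈ A | ReachIn Adj8 A c q} := by
  ext q
  refine and_congr_right fun _ => ⟨?_, fun h => ⟨c, hc, hF, h⟩⟩
  rintro ⟨d, hd, hdF, h⟩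
  by_cases hcd : c = d
  · exact hcd ▸ h
  · exact .head ⟨hc, hd, hF.adj8 hdF hcd⟩ h

lemma faceComponent_congr {A : Set (ℤ × ℤ)} {c F G : ℤ × ℤ} (hc : c ∈ A)
    (hF : IsSquareCorner c F) (hG : IsSquareCorner c G) :
    faceComponent A F = faceComponent A G := by
  rw [faceComponent_eq hc hF, faceComponent_eq hc hG]

open Classical in
/-- The parity of the number of vertical edges of the curve crossed by the horizontal ray going
left from the centre of the unit square `F`. -/
noncomputable def crossingParity {C : Set (ℤ × ℤ)} (hfin : C.Finite) (F : ℤ × ℤ) : ZMod 2 :=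
  ∑ c ∈ hfin.toFinset, if c.1 ≤ F.1 ∧ c.2 = F.2 ∧ (c.1, c.2 + 1) ∈ C then 1 else 0

open Classical in
lemma crossingParity_left {C : Set (ℤ × ℤ)} (hfin : C.Finite) (i j : ℤ) :
    crossingParity hfin (i, j) = crossingParity hfin (i - 1, j) +
      if (i, j) ∈ C ∧ (i, j + 1) ∈ C then 1 else 0 := by
  have hsingle : (if (i, j) ∈ C ∧ (i, j + 1) ∈ C then (1 : ZMod 2) else 0) =
      ∑ c ∈ hfin.toFinset, if c = (i, j) then (if (i, j + 1) ∈ C then 1 else 0) else 0 := by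
    rw [Finset.sum_ite_eq']
    simp only [Set.Finite.mem_toFinset]
    split_ifs <;> simp_all
  rw [hsingle, crossingParity, crossingParity, ← Finset.sum_add_distrib]
  refine Finset.sum_congr rfl fun c _ => ?_
  obtain ⟨a, b⟩ := c
  simp only [Prod.mk.injEq]
  by_cases hb : b = j
  · subst hb
    rcases lt_trichotomy a i with h | rfl | h
    · simp [h.le, h.ne, show a ≤ i - 1 by omega]
    · simp
    · simp [h.ne', show ¬ a ≤ i by omega, show ¬ a ≤ i - 1 by omega]
  · simp [hb]

lemma eq_of_forall_eq_sub_one {α : Type*} {f : ℤ → α} (hf : ∀ n, f n = f (n - 1)) (a b : ℤ) :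
    f a = f b := by
  have h (n : ℤ) : f n = f 0 := by
    induction n using Int.induction_on with
    | zero => rfl
    | succ k ih => rw [hf, add_sub_cancel_right, ih]
    | pred k ih => rw [← hf, ih]
  rw [h a, h b]

lemma exists_abs_coord_lt {C : Set (ℤ × ℤ)} (hfin : C.Finite) :
    ∃ N : ℤ, ∀ c ∈ C, |c.1| < N ∧ |c.2| < N := by
  obtain ⟨M, hM⟩ := (hfin.image fun c => max |c.1| |c.2|).bddAbove
  refine ⟨M + 1, fun c hc => ?_⟩
  have := hM (Set.mem_image_of_mem _ hc)
  simp only [max_le_iff] at this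
  omega

lemma crossingParity_eq_zero_of_forall {C : Set (ℤ × ℤ)} (hfin : C.Finite) {F : ℤ × ℤ}
    (h : ∀ c ∈ C, c.1 ≤ F.1 → c.2 ≠ F.2) : crossingParity hfin F = 0 := by
  refine Finset.sum_eq_zero fun c hc => if_neg ?_
  rintro ⟨h1, h2, -⟩
  exact h c (hfin.mem_toFinset.1 hc) h1 h2

open Classical in
lemma crossingParity_down {C : Set (ℤ × ℤ)} (hfin : C.Finite)
    (hdeg : ∀ p ∈ C, {q ∈ C | Adj4 p q}.ncard = 2) (i j : ℤ) :
    crossingParity hfin (i, j) = crossingParity hfin (i, j - 1) +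
      if (i, j) ∈ C ∧ (i + 1, j) ∈ C then 1 else 0 := by
  obtain ⟨N, hN⟩ := exists_abs_coord_lt hfin
  have hconst := eq_of_forall_eq_sub_one
    (f := fun i => crossingParity hfin (i, j) - crossingParity hfin (i, j - 1) -
      if (i, j) ∈ C ∧ (i + 1, j) ∈ C then 1 else 0) (fun n => ?_) i (-N)
  · have hleft (k : ℤ) : crossingParity hfin (-N, k) = 0 :=
      crossingParity_eq_zero_of_forall hfin fun c hc h => by
        have := neg_lt_of_abs_lt (hN c hc).1
        omega
    have hmem : (-N, j) ∉ C := fun h => by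
      have := neg_lt_of_abs_lt (hN _ h).1
      simp at this
    simp only [hleft, hmem, false_and, if_false, sub_zero] at hconst
    linear_combination hconst
  · rw [crossingParity_left hfin n j, crossingParity_left hfin n (j - 1)]
    simp only [sub_add_cancel]
    by_cases h : (n, j) ∈ C
    · have h2 := congrArg (Nat.cast : ℕ → ZMod 2) (sum_indicator_neighbors hdeg h)
      push_cast at h2
      have htwo : (2 : ZMod 2) = 0 := rfl
      simp only [h, true_and, and_true]
      linear_combination h2 -
        (if (n, j - 1) ∈ C then 1 else 0) * htwo - (if (n + 1, j) ∈ C then 1 else 0) * htwo + htwo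
    · simp [h]

lemma crossingParity_finite {C : Set (ℤ × ℤ)} (hfin : C.Finite)
    (hdeg : ∀ p ∈ C, {q ∈ C | Adj4 p q}.ncard = 2) :
    {F | crossingParity hfin F = 1}.Finite := by
  classical
  obtain ⟨N, hN⟩ := exists_abs_coord_lt hfin
  have hbd (a b : ℤ) (h : (a, b) ∈ C) : -N < a ∧ a < N ∧ -N < b ∧ b < N := by
    have := hN _ h
    simp only [abs_lt] at this
    omega
  refine (Set.finite_Icc (-N, -N) (N, N)).subset ?_
  rintro ⟨i, j⟩ hF
  by_contra hout
  rw [Set.mem_ofPred_eq] at hF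
  have hzero : crossingParity hfin (i, j) = 0 := by
    by_cases hi : N ≤ i
    · rw [eq_of_forall_eq_sub_one (f := fun j => crossingParity hfin (i, j)) (fun n => ?_) j (-N)]
      · refine crossingParity_eq_zero_of_forall hfin fun c hc _ => ?_
        have := hbd _ _ hc
        simp only
        omega
      · have : (i, n) ∉ C := fun h => by have := hbd _ _ h; omega
        simpa [this] using crossingParity_down hfin hdeg i n
    · refine crossingParity_eq_zero_of_forall hfin fun c hc h1 h2 => hout ?_
      have := hbd _ _ hc
      simp only at h1 h2
      simp only [Set.mem_Icc, Prod.mk_le_mk]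
      omega
  rw [hzero] at hF
  exact zero_ne_one hF

/-- The crossing parity is the same on all unit squares around a point off the curve. -/
lemma crossingParity_congr {C : Set (ℤ × ℤ)} (hfin : C.Finite)
    (hdeg : ∀ p ∈ C, {q ∈ C | Adj4 p q}.ncard = 2) {c F G : ℤ × ℤ} (hc : c ∉ C)
    (hF : IsSquareCorner c F) (hG : IsSquareCorner c G) :
    crossingParity hfin F = crossingParity hfin G := by
  classical
  obtain ⟨x, y⟩ := c
  have key (F : ℤ × ℤ) (hF : IsSquareCorner (x, y) F) :
      crossingParity hfin F = crossingParity hfin (x, y) := by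
    have h1 := crossingParity_left hfin x y
    have h2 := crossingParity_left hfin x (y - 1)
    have h3 := crossingParity_down hfin hdeg x y
    simp only [hc, false_and, and_false, sub_add_cancel, if_false, add_zero] at h1 h2 h3
    have hcases : F = (x, y) ∨ F = (x - 1, y) ∨ F = (x, y - 1) ∨ F = (x - 1, y - 1) := by
      obtain ⟨a, b⟩ := F
      simp only [IsSquareCorner, Prod.mk.injEq] at *
      omega
    rcases hcases with rfl | rfl | rfl | rfl
    · rfl
    · exact h1.symm
    · exact h3.symm
    · rw [← h2, ← h3]
  rw [key F hF, key G hG]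

lemma crossingParity_eq_of_mem {C : Set (ℤ × ℤ)} (hfin : C.Finite)
    (hdeg : ∀ p ∈ C, {q ∈ C | Adj4 p q}.ncard = 2) {F q : ℤ × ℤ}
    (hq : q ∈ faceComponent Cᶜ F) : crossingParity hfin q = crossingParity hfin F := by
  have hself (p : ℤ × ℤ) : IsSquareCorner p p := by simp [IsSquareCorner]
  obtain ⟨-, c, hc, hcF, hreach⟩ := hq
  induction hreach with
  | refl => exact crossingParity_congr hfin hdeg hc (hself c) hcF
  | @tail a b _ hab ih =>
    rw [← ih]
    obtain ⟨G, haG, hbG⟩ := hab.2.2.exists_isSquareCorner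
    rw [crossingParity_congr hfin hdeg hab.1 (hself a) haG,
      crossingParity_congr hfin hdeg hab.2.1 (hself b) hbG]

/-- The 8-components of `A` touching one of the four unit squares around `v`. -/
def vertexComponents (A : Set (ℤ × ℤ)) (v : ℤ × ℤ) : Set (Set (ℤ × ℤ)) :=
  {D | ∃ F, IsSquareCorner v F ∧ D = faceComponent A F}

lemma vertexComponents_eq (A : Set (ℤ × ℤ)) (x y : ℤ) :
    vertexComponents A (x, y) = {faceComponent A (x, y), faceComponent A (x - 1, y),
      faceComponent A (x, y - 1), faceComponent A (x - 1, y - 1)} := by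
  ext D
  simp only [vertexComponents, Set.mem_ofPred_eq, Set.mem_insert_iff, Set.mem_singleton_iff]
  constructor
  · rintro ⟨⟨a, b⟩, hF, rfl⟩
    have hcases : (a, b) = (x, y) ∨ (a, b) = (x - 1, y) ∨ (a, b) = (x, y - 1) ∨
        (a, b) = (x - 1, y - 1) := by
      simp only [IsSquareCorner, Prod.mk.injEq] at *
      omega
    rcases hcases with h | h | h | h <;> simp [h]
  · rintro (h | h | h | h) <;> exact ⟨_, by simp [IsSquareCorner], h⟩

/-- The two unit squares on either side of an edge of the curve account for all components
around either end of that edge. -/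
lemma vertexComponents_eq_pair {C : Set (ℤ × ℤ)}
    (hdeg : ∀ p ∈ C, {q ∈ C | Adj4 p q}.ncard = 2) {x y : ℤ} (h : (x, y) ∈ C) :
    ((x, y + 1) ∈ C → vertexComponents Cᶜ (x, y) =
      {faceComponent Cᶜ (x, y), faceComponent Cᶜ (x - 1, y)}) ∧
    ((x, y - 1) ∈ C → vertexComponents Cᶜ (x, y) =
      {faceComponent Cᶜ (x, y - 1), faceComponent Cᶜ (x - 1, y - 1)}) ∧
    ((x + 1, y) ∈ C → vertexComponents Cᶜ (x, y) =
      {faceComponent Cᶜ (x, y), faceComponent Cᶜ (x, y - 1)}) ∧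
    ((x - 1, y) ∈ C → vertexComponents Cᶜ (x, y) =
      {faceComponent Cᶜ (x - 1, y), faceComponent Cᶜ (x - 1, y - 1)}) := by
  have hN : (x, y + 1) ∉ C → faceComponent Cᶜ (x, y) = faceComponent Cᶜ (x - 1, y) :=
    fun h => faceComponent_congr h (by simp [IsSquareCorner]) (by simp [IsSquareCorner])
  have hS : (x, y - 1) ∉ C → faceComponent Cᶜ (x, y - 1) = faceComponent Cᶜ (x - 1, y - 1) :=
    fun h => faceComponent_congr h (by simp [IsSquareCorner]) (by simp [IsSquareCorner])
  have hE : (x + 1, y) ∉ C → faceComponent Cᶜ (x, y) = faceComponent Cᶜ (x, y - 1) :=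
    fun h => faceComponent_congr h (by simp [IsSquareCorner]) (by simp [IsSquareCorner])
  have hW : (x - 1, y) ∉ C → faceComponent Cᶜ (x - 1, y) = faceComponent Cᶜ (x - 1, y - 1) :=
    fun h => faceComponent_congr h (by simp [IsSquareCorner]) (by simp [IsSquareCorner])
  have hsum := sum_indicator_neighbors hdeg h
  rw [vertexComponents_eq]
  generalize faceComponent Cᶜ (x, y) = a at *
  generalize faceComponent Cᶜ (x - 1, y) = b at *
  generalize faceComponent Cᶜ (x, y - 1) = c at *
  generalize faceComponent Cᶜ (x - 1, y - 1) = d at *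
  refine ⟨fun hC => ?_, fun hC => ?_, fun hC => ?_, fun hC => ?_⟩ <;>
  · ext D
    simp only [Set.mem_insert_iff, Set.mem_singleton_iff]
    grind

lemma vertexComponents_congr {C : Set (ℤ × ℤ)}
    (hdeg : ∀ p ∈ C, {q ∈ C | Adj4 p q}.ncard = 2) {v w : ℤ × ℤ} (hv : v ∈ C) (hw : w ∈ C)
    (h : Adj4 v w) : vertexComponents Cᶜ v = vertexComponents Cᶜ w := by
  obtain ⟨x, y⟩ := v
  obtain ⟨x', y'⟩ := w
  have hcases : (x' = x ∧ y' = y + 1) ∨ (x' = x ∧ y = y' + 1) ∨ (x' = x + 1 ∧ y' = y) ∨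
      (x = x' + 1 ∧ y' = y) := by
    rw [adj4_iff] at h
    simp only [Prod.mk.injEq] at h
    omega
  have h1 := vertexComponents_eq_pair hdeg hv
  have h2 := vertexComponents_eq_pair hdeg hw
  rcases hcases with ⟨rfl, rfl⟩ | ⟨rfl, rfl⟩ | ⟨rfl, rfl⟩ | ⟨rfl, rfl⟩ <;>
    simp only [add_sub_cancel_right] at h1 h2
  · rw [h1.1 hw, h2.2.1 hv]
  · rw [h1.2.1 hw, h2.1 hv]
  · rw [h1.2.2.1 hw, h2.2.2.2 hv]
  · rw [h1.2.2.2 hw, h2.2.2.1 hv]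

/-- Around a point of the curve there are two unit squares, on different sides of the curve,
which account for all components around that point. -/
lemma exists_vertexComponents_eq_pair {C : Set (ℤ × ℤ)} (hfin : C.Finite)
    (hdeg : ∀ p ∈ C, {q ∈ C | Adj4 p q}.ncard = 2) {v : ℤ × ℤ} (hv : v ∈ C) :
    ∃ F G, crossingParity hfin F = 1 ∧ crossingParity hfin G = 0 ∧
      vertexComponents Cᶜ v = {faceComponent Cᶜ F, faceComponent Cᶜ G} := by
  classical
  suffices h : ∃ F G, crossingParity hfin F = crossingParity hfin G + 1 ∧
      vertexComponents Cᶜ v = {faceComponent Cᶜ F, faceComponent Cᶜ G} by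
    obtain ⟨F, G, hFG, hS⟩ := h
    have hbit (a : ZMod 2) : a = 0 ∨ a = 1 := by revert a; decide
    rcases hbit (crossingParity hfin G) with hG | hG
    · exact ⟨F, G, by rw [hFG, hG, zero_add], hG, hS⟩
    · exact ⟨G, F, hG, by rw [hFG, hG]; rfl, by rw [hS, Set.pair_comm]⟩
  obtain ⟨x, y⟩ := v
  obtain ⟨hN, hS, hE, hW⟩ := vertexComponents_eq_pair hdeg hv
  have hsum := sum_indicator_neighbors hdeg hv
  by_cases h1 : (x, y + 1) ∈ C
  · exact ⟨_, _, by simp [crossingParity_left hfin x y, h1, hv], hN h1⟩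
  by_cases h2 : (x, y - 1) ∈ C
  · exact ⟨_, _, by simp [crossingParity_left hfin x (y - 1), h2, hv], hS h2⟩
  by_cases h3 : (x + 1, y) ∈ C
  · exact ⟨_, _, by simp [crossingParity_down hfin hdeg x y, h3, hv], hE h3⟩
  · simp only [h1, h2, h3, if_false] at hsum
    split_ifs at hsum <;> omega

/-- Every 8-component of the complement of a nonempty set touches that set. -/
lemma exists_mem_vertexComponents {C : Set (ℤ × ℤ)} (hne : C.Nonempty) {p : ℤ × ℤ}
    (hp : p ∉ C) : ∃ v ∈ C, {q ∈ Cᶜ | ReachIn Adj8 Cᶜ p q} ∈ vertexComponents Cᶜ v := by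
  set D := {q ∈ Cᶜ | ReachIn Adj8 Cᶜ p q} with hD
  by_cases hclosed : ∀ q ∈ D, ∀ v, Adj4 q v → v ∉ C
  · exfalso
    have hstep (q : ℤ × ℤ) (hq : q ∈ D) (r : ℤ × ℤ) (h : Adj4 q r) : r ∈ D :=
      ⟨hclosed q hq r h, hq.2.tail ⟨hq.1, hclosed q hq r h, h.adj8⟩⟩
    have hadj (a b : ℤ) : Adj4 (a, b) (a + 1, b) ∧ Adj4 (a + 1, b) (a, b) ∧
        Adj4 (a, b) (a, b + 1) ∧ Adj4 (a, b + 1) (a, b) := by simp [Adj4]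
    have hshift (a b : ℤ) : ((a, b) ∈ D ↔ (a - 1, b) ∈ D) ∧ ((a, b) ∈ D ↔ (a, b - 1) ∈ D) := by
      have h1 := hadj (a - 1) b
      have h2 := hadj a (b - 1)
      simp only [sub_add_cancel] at h1 h2
      exact ⟨⟨fun h => hstep _ h _ h1.2.1, fun h => hstep _ h _ h1.1⟩,
        ⟨fun h => hstep _ h _ h2.2.2.2, fun h => hstep _ h _ h2.2.2.1⟩⟩
    obtain ⟨v, hv⟩ := hne
    have hpD : (p.1, p.2) ∈ D := ⟨hp, .refl⟩
    have e1 := eq_of_forall_eq_sub_one (f := fun a => (a, p.2) ∈ D)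
      (fun n => propext (hshift n p.2).1) p.1 v.1
    have e2 := eq_of_forall_eq_sub_one (f := fun b => (v.1, b) ∈ D)
      (fun n => propext (hshift v.1 n).2) p.2 v.2
    have hvD : (v.1, v.2) ∈ D := e2.mp (e1.mp hpD)
    exact hvD.1 hv
  · push Not at hclosed
    obtain ⟨q, hq, v, hqv, hv⟩ := hclosed
    obtain ⟨F, hqF, hvF⟩ := hqv.adj8.exists_isSquareCorner
    refine ⟨v, hv, F, hvF, ?_⟩
    rw [faceComponent_eq hq.1 hqF]
    ext r
    exact and_congr_right fun _ =>
      ⟨fun h => hq.2.symm_of_adj8.trans h, fun h => hq.2.trans h⟩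

/-- **Digital Jordan curve theorem.**
If `C ⊆ ℤ²` is a simple closed 4-curve with at least 5 points (finite, 4-connected,
every point of `C` having exactly two 4-adjacent points in `C`), then `ℤ² \ C` has
exactly two 8-connected components, exactly one of which is finite. -/
theorem digital_jordan_curve (C : Set (ℤ × ℤ)) (hfin : C.Finite) (hcard : 5 ≤ C.ncard)
    (hconn : IsConn Adj4 C) (hdeg : ∀ p ∈ C, {q ∈ C | Adj4 p q}.ncard = 2) :
    ∃ D₁ D₂ : Set (ℤ × ℤ), D₁ ≠ D₂ ∧ Components8 Cᶜ = {D₁, D₂} ∧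
      D₁.Finite ∧ D₂.Infinite := by
  obtain ⟨v, hv⟩ : C.Nonempty := by
    rw [Set.nonempty_iff_ne_empty]
    rintro rfl
    simp at hcard
  obtain ⟨F, G, hF, hG, hS⟩ := exists_vertexComponents_eq_pair hfin hdeg hv
  have hcorner := exists_isSquareCorner_notMem hcard hconn hdeg
  have hmem (E : ℤ × ℤ) : faceComponent Cᶜ E ∈ Components8 Cᶜ := by
    obtain ⟨c, hc, hcE⟩ := hcorner E
    exact ⟨c, hc, faceComponent_eq hc hcE⟩
  have hconst (w : ℤ × ℤ) (hw : w ∈ C) : vertexComponents Cᶜ w = vertexComponents Cᶜ v := by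
    have hreach := hconn v hv w hw
    clear hw
    induction hreach with
    | refl => rfl
    | tail _ hab ih => rw [← ih, vertexComponents_congr hdeg hab.1 hab.2.1 hab.2.2]
  have htwo (p : ℤ × ℤ) (hp : p ∈ Cᶜ) : {q ∈ Cᶜ | ReachIn Adj8 Cᶜ p q} ∈
      ({faceComponent Cᶜ F, faceComponent Cᶜ G} : Set (Set (ℤ × ℤ))) := by
    obtain ⟨w, hw, h⟩ := exists_mem_vertexComponents ⟨v, hv⟩ hp
    rwa [hconst w hw, hS] at h
  have hfinite : (faceComponent Cᶜ F).Finite :=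
    (crossingParity_finite hfin hdeg).subset fun q hq =>
      (crossingParity_eq_of_mem hfin hdeg hq).trans hF
  refine ⟨faceComponent Cᶜ F, faceComponent Cᶜ G, fun heq => ?_, ?_, hfinite, fun hGfin => ?_⟩
  · obtain ⟨c, hc, hcF⟩ := hcorner F
    have hcmem : c ∈ faceComponent Cᶜ F := ⟨hc, c, hc, hcF, .refl⟩
    have h1 := crossingParity_eq_of_mem hfin hdeg hcmem
    have h2 := crossingParity_eq_of_mem hfin hdeg (heq ▸ hcmem)
    rw [h1, hF, hG] at h2
    exact one_ne_zero h2
  · refine Set.Subset.antisymm ?_ ?_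
    · rintro D ⟨p, hp, rfl⟩
      exact htwo p hp
    · rintro D (rfl | rfl)
      exacts [hmem F, hmem G]
  · refine Set.infinite_univ (α := ℤ × ℤ)
      (((hfin.union hfinite).union hGfin).subset fun p _ => ?_)
    by_cases hp : p ∈ C
    · exact .inl (.inl hp)
    · have hself : p ∈ {q ∈ Cᶜ | ReachIn Adj8 Cᶜ p q} := ⟨hp, .refl⟩
      rcases htwo p hp with h | h
      · exact .inl (.inr (h ▸ hself))
      · exact .inr (h ▸ hself)
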